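/- arXiv:1808.08513 — 3 statements merged into one kernel-verified Lean document; each statement's English description precedes it below -/
import Mathlib

section
/- In a differential category with antiderivatives, the Poincaré Condition holds: if a map f : !A ⊗ A → B satisfies (d_A ⊗ 1_A) f = (1_{!A} ⊗ σ_{A,A})(d_A ⊗ 1_A) f, then d_A s_A f = f. -/
universe u v

/-- A symmetric strict monoidal category (data and the coherence axioms that
do not require transport along object equalities). Composition `comp f g`
is in diagrammatic order: first `f`, then `g`. -/
structure SMCData where
  Obj : Type u
  Hom : Obj → Obj → Type v
  id : ∀ A : Obj, Hom A A
  comp : ∀ {A B C : Obj}, Hom A B → Hom B C → Hom A C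
  id_comp : ∀ {A B : Obj} (f : Hom A B), comp (id A) f = f
  comp_id : ∀ {A B : Obj} (f : Hom A B), comp f (id B) = f
  comp_assoc : ∀ {A B C D : Obj} (f : Hom A B) (g : Hom B C) (h : Hom C D),
    comp (comp f g) h = comp f (comp g h)
  ten : Obj → Obj → Obj
  unit : Obj
  tHom : ∀ {A B C D : Obj}, Hom A C → Hom B D → Hom (ten A B) (ten C D)
  tHom_id : ∀ (A B : Obj), tHom (id A) (id B) = id (ten A B)
  tHom_comp : ∀ {A₁ A₂ A₃ B₁ B₂ B₃ : Obj} (f : Hom A₁ A₂) (g : Hom A₂ A₃)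
    (f' : Hom B₁ B₂) (g' : Hom B₂ B₃),
    tHom (comp f g) (comp f' g') = comp (tHom f f') (tHom g g')
  tenAssoc : ∀ (A B C : Obj), ten (ten A B) C = ten A (ten B C)
  unit_ten : ∀ (A : Obj), ten unit A = A
  ten_unit : ∀ (A : Obj), ten A unit = A
  sw : ∀ (A B : Obj), Hom (ten A B) (ten B A)
  sw_natural : ∀ {A B C D : Obj} (f : Hom A C) (g : Hom B D),
    comp (tHom f g) (sw C D) = comp (sw A B) (tHom g f)
  sw_sw : ∀ (A B : Obj), comp (sw A B) (sw B A) = id (ten A B)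

/-- The identity morphism transported along an equality of objects. In a
strict monoidal category the structural isomorphisms are identities, so these
are used to express the strictness identifications. -/
def SMCData.cHom (C : SMCData) {A B : C.Obj} (h : A = B) : C.Hom A B := by
  cases h; exact C.id A
/-- A differential category: an additive symmetric strict monoidal category with a coalgebra modality and a deriving transformation. -/
structure DiffCat extends SMCData where
  -- strictness coherence: associativity and unit identifications are
  -- (transported) identities compatible with the tensor of morphisms,
  -- and the symmetry satisfies the (strict) hexagon identity
  assoc_natural : ∀ {A₁ A₂ B₁ B₂ C₁ C₂ : Obj} (f : Hom A₁ A₂) (g : Hom B₁ B₂) (h : Hom C₁ C₂),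
    comp (tHom (tHom f g) h) (toSMCData.cHom (tenAssoc A₂ B₂ C₂)) =
      comp (toSMCData.cHom (tenAssoc A₁ B₁ C₁)) (tHom f (tHom g h))
  unit_ten_natural : ∀ {A B : Obj} (f : Hom A B),
    comp (tHom (id unit) f) (toSMCData.cHom (unit_ten B)) =
      comp (toSMCData.cHom (unit_ten A)) f
  ten_unit_natural : ∀ {A B : Obj} (f : Hom A B),
    comp (tHom f (id unit)) (toSMCData.cHom (ten_unit B)) =
      comp (toSMCData.cHom (ten_unit A)) f
  hexagon : ∀ (A B C : Obj),
    comp (toSMCData.cHom (tenAssoc A B C))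
      (comp (tHom (id A) (sw B C))
        (comp (toSMCData.cHom (tenAssoc A C B).symm)
          (comp (tHom (sw A C) (id B)) (toSMCData.cHom (tenAssoc C A B))))) =
      sw (ten A B) C
  -- additive enrichment: hom-sets are commutative monoids and composition
  -- and tensor preserve the additive structure
  add : ∀ {A B : Obj}, Hom A B → Hom A B → Hom A B
  zero : ∀ {A B : Obj}, Hom A B
  add_assoc : ∀ {A B : Obj} (f g h : Hom A B), add (add f g) h = add f (add g h)
  add_comm : ∀ {A B : Obj} (f g : Hom A B), add f g = add g f
  add_zero : ∀ {A B : Obj} (f : Hom A B), add f zero = f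
  comp_add : ∀ {A B C : Obj} (f : Hom A B) (g h : Hom B C),
    comp f (add g h) = add (comp f g) (comp f h)
  add_comp : ∀ {A B C : Obj} (f g : Hom A B) (h : Hom B C),
    comp (add f g) h = add (comp f h) (comp g h)
  comp_zero : ∀ {A B C : Obj} (f : Hom A B), comp f (zero : Hom B C) = zero
  zero_comp : ∀ {A B C : Obj} (f : Hom B C), comp (zero : Hom A B) f = zero
  tHom_add_left : ∀ {A B C D : Obj} (f g : Hom A C) (h : Hom B D),
    tHom (add f g) h = add (tHom f h) (tHom g h)
  tHom_add_right : ∀ {A B C D : Obj} (f : Hom A C) (g h : Hom B D),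
    tHom f (add g h) = add (tHom f g) (tHom f h)
  tHom_zero_left : ∀ {A B C D : Obj} (h : Hom B D),
    tHom (zero : Hom A C) h = zero
  tHom_zero_right : ∀ {A B C D : Obj} (f : Hom A C),
    tHom f (zero : Hom B D) = zero
  -- a coalgebra modality: a comonad (bang, rho, eps) with natural
  -- cocommutative comonoid structure (cmul, cunit) on each bang A,
  -- for which each rho A is a comonoid morphism
  bang : Obj → Obj
  bangMap : ∀ {A B : Obj}, Hom A B → Hom (bang A) (bang B)
  bangMap_id : ∀ (A : Obj), bangMap (id A) = id (bang A)
  bangMap_comp : ∀ {A B C : Obj} (f : Hom A B) (g : Hom B C),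
    bangMap (comp f g) = comp (bangMap f) (bangMap g)
  rho : ∀ (A : Obj), Hom (bang A) (bang (bang A))
  eps : ∀ (A : Obj), Hom (bang A) A
  cmul : ∀ (A : Obj), Hom (bang A) (ten (bang A) (bang A))
  cunit : ∀ (A : Obj), Hom (bang A) unit
  rho_natural : ∀ {A B : Obj} (f : Hom A B),
    comp (bangMap f) (rho B) = comp (rho A) (bangMap (bangMap f))
  eps_natural : ∀ {A B : Obj} (f : Hom A B),
    comp (bangMap f) (eps B) = comp (eps A) f
  cmul_natural : ∀ {A B : Obj} (f : Hom A B),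
    comp (bangMap f) (cmul B) = comp (cmul A) (tHom (bangMap f) (bangMap f))
  cunit_natural : ∀ {A B : Obj} (f : Hom A B),
    comp (bangMap f) (cunit B) = cunit A
  rho_eps : ∀ (A : Obj), comp (rho A) (eps (bang A)) = id (bang A)
  rho_bangMap_eps : ∀ (A : Obj), comp (rho A) (bangMap (eps A)) = id (bang A)
  rho_rho : ∀ (A : Obj), comp (rho A) (rho (bang A)) = comp (rho A) (bangMap (rho A))
  cmul_coassoc : ∀ (A : Obj),
    comp (cmul A) (comp (tHom (cmul A) (id (bang A)))
      (toSMCData.cHom (tenAssoc (bang A) (bang A) (bang A)))) =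
    comp (cmul A) (tHom (id (bang A)) (cmul A))
  cmul_counit_left : ∀ (A : Obj),
    comp (cmul A) (comp (tHom (cunit A) (id (bang A)))
      (toSMCData.cHom (unit_ten (bang A)))) = id (bang A)
  cmul_counit_right : ∀ (A : Obj),
    comp (cmul A) (comp (tHom (id (bang A)) (cunit A))
      (toSMCData.cHom (ten_unit (bang A)))) = id (bang A)
  cmul_cocomm : ∀ (A : Obj), comp (cmul A) (sw (bang A) (bang A)) = cmul A
  rho_cmul : ∀ (A : Obj),
    comp (rho A) (cmul (bang A)) = comp (cmul A) (tHom (rho A) (rho A))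
  rho_cunit : ∀ (A : Obj), comp (rho A) (cunit (bang A)) = cunit A
  -- a deriving transformation [d.1]-[d.5]
  der : ∀ (A : Obj), Hom (ten (bang A) A) (bang A)
  der_natural : ∀ {A B : Obj} (f : Hom A B),
    comp (tHom (bangMap f) f) (der B) = comp (der A) (bangMap f)
  -- [d.1] constant rule
  der_cunit : ∀ (A : Obj), comp (der A) (cunit A) = zero
  -- [d.2] Leibniz rule
  der_cmul : ∀ (A : Obj),
    comp (der A) (cmul A) =
      add
        (comp (tHom (cmul A) (id A))
          (comp (toSMCData.cHom (tenAssoc (bang A) (bang A) A))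
            (comp (tHom (id (bang A)) (sw (bang A) A))
              (comp (toSMCData.cHom (tenAssoc (bang A) A (bang A)).symm)
                (tHom (der A) (id (bang A)))))))
        (comp (tHom (cmul A) (id A))
          (comp (toSMCData.cHom (tenAssoc (bang A) (bang A) A))
            (tHom (id (bang A)) (der A))))
  -- [d.3] linear rule
  der_eps : ∀ (A : Obj),
    comp (der A) (eps A) = comp (tHom (cunit A) (id A)) (toSMCData.cHom (unit_ten A))
  -- [d.4] chain rule
  der_rho : ∀ (A : Obj),
    comp (der A) (rho A) =
      comp (tHom (cmul A) (id A))
        (comp (toSMCData.cHom (tenAssoc (bang A) (bang A) A))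
          (comp (tHom (rho A) (der A)) (der (bang A))))
  -- [d.5] interchange rule
  der_interchange : ∀ (A : Obj),
    comp (tHom (der A) (id A)) (der A) =
      comp (toSMCData.cHom (tenAssoc (bang A) A A))
        (comp (tHom (id (bang A)) (sw A A))
          (comp (toSMCData.cHom (tenAssoc (bang A) A A).symm)
            (comp (tHom (der A) (id A)) (der A))))

def DiffCat.cHom (C : DiffCat) {A B : C.Obj} (h : A = B) : C.Hom A B :=
  C.toSMCData.cHom h

namespace DiffCat

variable (C : DiffCat)

/-- The coderiving transformation d°_A := Δ_A (1 ⊗ ε_A). -/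
def dcirc (A : C.Obj) : C.Hom (C.bang A) (C.ten (C.bang A) A) :=
  C.comp (C.cmul A) (C.tHom (C.id (C.bang A)) (C.eps A))

/-- K_A := d°_A d_A + !(0). -/
def K (A : C.Obj) : C.Hom (C.bang A) (C.bang A) :=
  C.add (C.comp (C.dcirc A) (C.der A)) (C.bangMap (C.zero : C.Hom A A))

/-- J_A := d°_A d_A + 1_{!A}. -/
def J (A : C.Obj) : C.Hom (C.bang A) (C.bang A) :=
  C.add (C.comp (C.dcirc A) (C.der A)) (C.id (C.bang A))

/-- The deriving transformation at the monoidal unit, under the strictness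
identification !R ⊗ R = !R. -/
def dR : C.Hom (C.bang C.unit) (C.bang C.unit) :=
  C.comp (C.cHom (C.ten_unit (C.bang C.unit)).symm) (C.der C.unit)

/-- The coderiving transformation at the monoidal unit, under the strictness
identification !R ⊗ R = !R. -/
def dcircR : C.Hom (C.bang C.unit) (C.bang C.unit) :=
  C.comp (C.dcirc C.unit) (C.cHom (C.ten_unit (C.bang C.unit)))

end DiffCat

namespace SMCData

variable (C : SMCData)

theorem cHom_rfl (A : C.Obj) : C.cHom (rfl : A = A) = C.id A := rfl

theorem cHom_comp_cHom {X Y Z : C.Obj} (h : X = Y) (h' : Y = Z) :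
    C.comp (C.cHom h) (C.cHom h') = C.cHom (h.trans h') := by
  subst h h'
  exact C.id_comp _

theorem cHom_tHom_id {X Y : C.Obj} (h : X = Y) (Z : C.Obj) :
    C.tHom (C.cHom h) (C.id Z) = C.cHom (congrArg (fun W => C.ten W Z) h) := by
  subst h
  exact C.tHom_id _ _

theorem id_tHom_cHom {X Y : C.Obj} (h : X = Y) (Z : C.Obj) :
    C.tHom (C.id Z) (C.cHom h) = C.cHom (congrArg (fun W => C.ten Z W) h) := by
  subst h
  exact C.tHom_id _ _

/-- A composite with a transported identity can be moved across an equation. -/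
theorem comp_cHom_symm {W X Y : C.Obj} (h : X = Y) {f : C.Hom W X} {g : C.Hom W Y}
    (hfg : C.comp f (C.cHom h) = g) : C.comp g (C.cHom h.symm) = f := by
  subst h
  subst hfg
  simp only [cHom_rfl, C.comp_id]

theorem id_tHom_comp {X Y Z W : C.Obj} (f : C.Hom X Y) (g : C.Hom Y Z) :
    C.tHom (C.id W) (C.comp f g) = C.comp (C.tHom (C.id W) f) (C.tHom (C.id W) g) := by
  rw [← C.tHom_comp, C.id_comp]

theorem comp_tHom_id {X Y Z W : C.Obj} (f : C.Hom X Y) (g : C.Hom Y Z) :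
    C.tHom (C.comp f g) (C.id W) = C.comp (C.tHom f (C.id W)) (C.tHom g (C.id W)) := by
  rw [← C.tHom_comp, C.id_comp]

/-- The symmetry acting on the last two factors of a triple tensor product. -/
def swapLast (X Y Z : C.Obj) : C.Hom (C.ten (C.ten X Y) Z) (C.ten (C.ten X Z) Y) :=
  C.comp (C.cHom (C.tenAssoc X Y Z))
    (C.comp (C.tHom (C.id X) (C.sw Y Z)) (C.cHom (C.tenAssoc X Z Y).symm))

end SMCData

namespace DiffCat

variable (C : DiffCat)

theorem assoc_symm_natural {A₁ A₂ B₁ B₂ C₁ C₂ : C.Obj}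
    (f : C.Hom A₁ A₂) (g : C.Hom B₁ B₂) (h : C.Hom C₁ C₂) :
    C.comp (C.tHom f (C.tHom g h)) (C.toSMCData.cHom (C.tenAssoc A₂ B₂ C₂).symm) =
      C.comp (C.toSMCData.cHom (C.tenAssoc A₁ B₁ C₁).symm) (C.tHom (C.tHom f g) h) := by
  refine C.comp_cHom_symm (C.tenAssoc A₂ B₂ C₂) ?_
  rw [C.comp_assoc, C.assoc_natural, ← C.comp_assoc, C.cHom_comp_cHom, C.cHom_rfl, C.id_comp]

theorem swapLast_natural {A₁ A₂ B₁ B₂ C₁ C₂ : C.Obj}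
    (f : C.Hom A₁ A₂) (g : C.Hom B₁ B₂) (h : C.Hom C₁ C₂) :
    C.comp (C.tHom (C.tHom f g) h) (C.swapLast A₂ B₂ C₂) =
      C.comp (C.swapLast A₁ B₁ C₁) (C.tHom (C.tHom f h) g) := by
  simp only [SMCData.swapLast, C.comp_assoc, ← C.assoc_symm_natural]
  rw [← C.comp_assoc, C.assoc_natural, C.comp_assoc]
  congr 1
  rw [← C.comp_assoc, ← C.comp_assoc, ← C.tHom_comp, ← C.tHom_comp, C.sw_natural,
    C.id_comp, C.comp_id]

theorem dcirc_natural {A B : C.Obj} (f : C.Hom A B) :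
    C.comp (C.bangMap f) (C.dcirc B) = C.comp (C.dcirc A) (C.tHom (C.bangMap f) f) := by
  unfold dcirc
  rw [← C.comp_assoc, C.cmul_natural, C.comp_assoc, C.comp_assoc, ← C.tHom_comp, ← C.tHom_comp,
    C.eps_natural, C.comp_id, C.id_comp]

theorem J_natural {A B : C.Obj} (f : C.Hom A B) :
    C.comp (C.bangMap f) (C.J B) = C.comp (C.J A) (C.bangMap f) := by
  unfold J
  rw [C.comp_add, C.add_comp, C.comp_id, C.id_comp, ← C.comp_assoc, C.dcirc_natural,
    C.comp_assoc, C.der_natural, C.comp_assoc]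

/-- Differentiating and then coderiving, computed by the Leibniz and linear rules. -/
theorem der_dcirc (A : C.Obj) :
    C.comp (C.der A) (C.dcirc A) =
      C.add (C.comp (C.tHom (C.dcirc A) (C.id A))
        (C.comp (C.swapLast (C.bang A) A A) (C.tHom (C.der A) (C.id A))))
        (C.id (C.ten (C.bang A) A)) := by
  have hleft : C.comp (C.tHom (C.der A) (C.id (C.bang A))) (C.tHom (C.id (C.bang A)) (C.eps A)) =
      C.comp (C.tHom (C.tHom (C.id (C.bang A)) (C.id A)) (C.eps A))
        (C.tHom (C.der A) (C.id A)) := by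
    rw [← C.tHom_comp, ← C.tHom_comp, C.tHom_id]
    simp only [C.id_comp, C.comp_id]
  have hright : C.comp (C.tHom (C.cmul A) (C.id A))
      (C.comp (C.toSMCData.cHom (C.tenAssoc (C.bang A) (C.bang A) A))
        (C.tHom (C.id (C.bang A)) (C.comp (C.tHom (C.cunit A) (C.id A))
          (C.toSMCData.cHom (C.unit_ten A))))) = C.id (C.ten (C.bang A) A) := by
    rw [C.id_tHom_comp, ← C.comp_assoc (C.toSMCData.cHom _), ← C.assoc_natural, C.id_tHom_cHom,
      C.comp_assoc, C.cHom_comp_cHom,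
      ← C.cHom_tHom_id (C.ten_unit (C.bang A)) A, ← C.comp_tHom_id, ← C.comp_tHom_id,
      C.cmul_counit_right, C.tHom_id]
  have hd : C.comp (C.der A) (C.dcirc A) = C.comp (C.comp (C.der A) (C.cmul A))
      (C.tHom (C.id (C.bang A)) (C.eps A)) := by
    rw [dcirc, C.comp_assoc]
  rw [hd, C.der_cmul, C.add_comp]
  congr 1
  · rw [dcirc, C.comp_tHom_id, C.comp_assoc _ (C.tHom (C.tHom _ _) _),
      ← C.comp_assoc (C.tHom (C.tHom _ _) _), C.swapLast_natural]
    simp only [C.comp_assoc, SMCData.swapLast, hleft]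
  · rw [C.comp_assoc, C.comp_assoc, ← C.id_tHom_comp, C.der_eps, hright]

theorem cmul_cmul_swapLast (A : C.Obj) :
    C.comp (C.cmul A) (C.comp (C.tHom (C.cmul A) (C.id (C.bang A)))
      (C.swapLast (C.bang A) (C.bang A) (C.bang A))) =
      C.comp (C.cmul A) (C.tHom (C.cmul A) (C.id (C.bang A))) := by
  have hco := C.cmul_coassoc A
  rw [← C.comp_assoc] at hco
  rw [SMCData.swapLast, ← C.comp_assoc, ← C.comp_assoc, hco, ← C.comp_assoc,
    C.comp_assoc (C.cmul A), ← C.id_tHom_comp, C.cmul_cocomm]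
  exact C.comp_cHom_symm _ hco

theorem dcirc_dcirc (A : C.Obj) :
    C.comp (C.dcirc A) (C.tHom (C.dcirc A) (C.id A)) =
      C.comp (C.comp (C.cmul A) (C.tHom (C.cmul A) (C.id (C.bang A))))
        (C.tHom (C.tHom (C.id (C.bang A)) (C.eps A)) (C.eps A)) := by
  simp only [dcirc, C.comp_assoc, ← C.tHom_comp, C.id_comp, C.comp_id]

theorem dcirc_dcirc_swapLast (A : C.Obj) :
    C.comp (C.comp (C.dcirc A) (C.tHom (C.dcirc A) (C.id A))) (C.swapLast (C.bang A) A A) =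
      C.comp (C.dcirc A) (C.tHom (C.dcirc A) (C.id A)) := by
  rw [dcirc_dcirc, C.comp_assoc, C.swapLast_natural, ← C.comp_assoc, C.comp_assoc (C.cmul A),
    C.cmul_cmul_swapLast]

theorem der_K (A : C.Obj) :
    C.comp (C.der A) (C.K A) = C.comp (C.der A) (C.comp (C.dcirc A) (C.der A)) := by
  rw [K, C.comp_add, ← C.der_natural, C.tHom_zero_right, C.zero_comp, C.add_zero]

theorem K_dcirc (A : C.Obj) :
    C.comp (C.K A) (C.dcirc A) = C.comp (C.dcirc A) (C.tHom (C.J A) (C.id A)) := by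
  rw [K, C.add_comp, C.dcirc_natural, C.tHom_zero_right, C.comp_zero, C.add_zero, C.comp_assoc,
    C.der_dcirc, C.comp_add, J, C.tHom_add_left, C.comp_add, C.tHom_id]
  congr 1
  rw [← C.comp_assoc, ← C.comp_assoc, C.dcirc_dcirc_swapLast, C.comp_assoc, C.comp_tHom_id]

/-- Maps with symmetric derivative are carried by `d d°` to their precomposite with `J ⊗ 1`. -/
theorem der_dcirc_comp {A B : C.Obj} (f : C.Hom (C.ten (C.bang A) A) B)
    (hf : C.comp (C.tHom (C.der A) (C.id A)) f =
      C.comp (C.swapLast (C.bang A) A A) (C.comp (C.tHom (C.der A) (C.id A)) f)) :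
    C.comp (C.der A) (C.comp (C.dcirc A) f) = C.comp (C.tHom (C.J A) (C.id A)) f := by
  rw [← C.comp_assoc, C.der_dcirc, C.add_comp, J, C.tHom_add_left, C.add_comp, C.tHom_id,
    C.comp_assoc, C.comp_assoc, ← hf, C.comp_tHom_id, C.comp_assoc]

/-- The map `K⁻¹` at `!A` yields the inverse `ρ K⁻¹ d° (!ε ⊗ e)` of `J` at `A`. -/
def JInv (A : C.Obj) (k : C.Hom (C.bang (C.bang A)) (C.bang (C.bang A))) :
    C.Hom (C.bang A) (C.bang A) :=
  C.comp (C.rho A) (C.comp k (C.comp (C.dcirc (C.bang A))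
    (C.comp (C.tHom (C.bangMap (C.eps A)) (C.cunit A))
      (C.toSMCData.cHom (C.ten_unit (C.bang A))))))

theorem JInv_comp_J (A : C.Obj) (k : C.Hom (C.bang (C.bang A)) (C.bang (C.bang A)))
    (hk : C.comp k (C.K (C.bang A)) = C.id (C.bang (C.bang A))) :
    C.comp (C.JInv A k) (C.J A) = C.id (C.bang A) := by
  have hJ : C.comp (C.tHom (C.bangMap (C.eps A)) (C.cunit A)) (C.tHom (C.J A) (C.id C.unit)) =
      C.comp (C.tHom (C.J (C.bang A)) (C.id (C.bang A)))
        (C.tHom (C.bangMap (C.eps A)) (C.cunit A)) := by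
    rw [← C.tHom_comp, ← C.tHom_comp, C.J_natural, C.comp_id, C.id_comp]
  have hrho : C.comp (C.rho A) (C.comp (C.dcirc (C.bang A))
      (C.tHom (C.bangMap (C.eps A)) (C.cunit A))) =
      C.comp (C.cmul A) (C.tHom (C.id (C.bang A)) (C.cunit A)) := by
    rw [dcirc, C.comp_assoc, ← C.comp_assoc, C.rho_cmul, C.comp_assoc, ← C.tHom_comp,
      ← C.tHom_comp, C.id_comp, C.rho_bangMap_eps, ← C.comp_assoc, C.rho_eps, C.id_comp]
  calc C.comp (C.JInv A k) (C.J A)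
      = C.comp (C.rho A) (C.comp k (C.comp (C.comp (C.dcirc (C.bang A))
          (C.tHom (C.J (C.bang A)) (C.id (C.bang A))))
          (C.comp (C.tHom (C.bangMap (C.eps A)) (C.cunit A))
            (C.toSMCData.cHom (C.ten_unit (C.bang A)))))) := by
        simp only [JInv, C.comp_assoc]
        rw [← C.ten_unit_natural, ← C.comp_assoc (C.tHom (C.bangMap _) _), hJ, C.comp_assoc]
    _ = C.comp (C.comp (C.rho A) (C.comp (C.dcirc (C.bang A))
          (C.tHom (C.bangMap (C.eps A)) (C.cunit A))))
          (C.toSMCData.cHom (C.ten_unit (C.bang A))) := by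
        rw [← C.K_dcirc, C.comp_assoc (C.K _), ← C.comp_assoc k, hk, C.id_comp]
        simp only [C.comp_assoc]
    _ = C.id (C.bang A) := by
        rw [hrho, C.comp_assoc, C.cmul_counit_right]

end DiffCat

/-- The Poincaré Condition: in a differential category with antiderivatives,
if (d_A ⊗ 1_A) f = (1 ⊗ σ_{A,A})(d_A ⊗ 1_A) f then d_A s_A f = f, where
s_A := K_A⁻¹ d°_A. -/
theorem statement7 (C : DiffCat)
    (Kinv : ∀ A : C.Obj, C.Hom (C.bang A) (C.bang A))
    (hK1 : ∀ A : C.Obj, C.comp (C.K A) (Kinv A) = C.id (C.bang A))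
    (hK2 : ∀ A : C.Obj, C.comp (Kinv A) (C.K A) = C.id (C.bang A))
    (A B : C.Obj) (f : C.Hom (C.ten (C.bang A) A) B)
    (hf : C.comp (C.tHom (C.der A) (C.id A)) f =
      C.comp (C.cHom (C.tenAssoc (C.bang A) A A))
        (C.comp (C.tHom (C.id (C.bang A)) (C.sw A A))
          (C.comp (C.cHom (C.tenAssoc (C.bang A) A A).symm)
            (C.comp (C.tHom (C.der A) (C.id A)) f)))) :
    C.comp (C.der A) (C.comp (C.comp (Kinv A) (C.dcirc A)) f) = f := by
  have hJ := C.JInv_comp_J A (Kinv (C.bang A)) (hK2 (C.bang A))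
  have hf' : C.comp (C.tHom (C.der A) (C.id A)) f =
      C.comp (C.swapLast (C.bang A) A A) (C.comp (C.tHom (C.der A) (C.id A)) f) := by
    simp only [SMCData.swapLast, C.comp_assoc]
    exact hf
  have hd : C.comp (C.tHom (C.der A) (C.id A)) (C.der A) =
      C.comp (C.swapLast (C.bang A) A A) (C.comp (C.tHom (C.der A) (C.id A)) (C.der A)) := by
    simp only [SMCData.swapLast, C.comp_assoc]
    exact C.der_interchange A
  have cancel : ∀ {X : C.Obj} (g : C.Hom (C.ten (C.bang A) A) X),
      C.comp (C.tHom (C.JInv A (Kinv (C.bang A))) (C.id A))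
        (C.comp (C.tHom (C.J A) (C.id A)) g) = g := by
    intro X g
    rw [← C.comp_assoc, ← C.comp_tHom_id, hJ, C.tHom_id, C.id_comp]
  have hder : C.comp (C.der A) (Kinv A) =
      C.comp (C.tHom (C.JInv A (Kinv (C.bang A))) (C.id A)) (C.der A) := by
    rw [← cancel (C.comp (C.der A) (Kinv A)), ← C.comp_assoc (C.tHom (C.J A) _),
      ← C.der_dcirc_comp _ hd, ← C.der_K, C.comp_assoc (C.der A), hK1, C.comp_id]
  rw [C.comp_assoc, ← C.comp_assoc, hder, C.comp_assoc, C.der_dcirc_comp f hf', cancel]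
end

section
/- A differential linear category has antiderivatives if and only if the component K_R at the monoidal unit is an isomorphism; moreover, when K_R is an isomorphism, the inverse of K_A is given by K_A⁻¹ = (m_R ⊗ 1_{!A})(K_R⁻¹ ⊗ 1_{!A}) m_{R,A}. -/
universe u v

/-- A differential linear category: a differential category whose coalgebra modality is a monoidal coalgebra modality. -/
structure DiffLinCat extends SMCData where
  -- strictness coherence: associativity and unit identifications are
  -- (transported) identities compatible with the tensor of morphisms,
  -- and the symmetry satisfies the (strict) hexagon identity
  assoc_natural : ∀ {A₁ A₂ B₁ B₂ C₁ C₂ : Obj} (f : Hom A₁ A₂) (g : Hom B₁ B₂) (h : Hom C₁ C₂),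
    comp (tHom (tHom f g) h) (toSMCData.cHom (tenAssoc A₂ B₂ C₂)) =
      comp (toSMCData.cHom (tenAssoc A₁ B₁ C₁)) (tHom f (tHom g h))
  unit_ten_natural : ∀ {A B : Obj} (f : Hom A B),
    comp (tHom (id unit) f) (toSMCData.cHom (unit_ten B)) =
      comp (toSMCData.cHom (unit_ten A)) f
  ten_unit_natural : ∀ {A B : Obj} (f : Hom A B),
    comp (tHom f (id unit)) (toSMCData.cHom (ten_unit B)) =
      comp (toSMCData.cHom (ten_unit A)) f
  hexagon : ∀ (A B C : Obj),
    comp (toSMCData.cHom (tenAssoc A B C))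
      (comp (tHom (id A) (sw B C))
        (comp (toSMCData.cHom (tenAssoc A C B).symm)
          (comp (tHom (sw A C) (id B)) (toSMCData.cHom (tenAssoc C A B))))) =
      sw (ten A B) C
  -- additive enrichment: hom-sets are commutative monoids and composition
  -- and tensor preserve the additive structure
  add : ∀ {A B : Obj}, Hom A B → Hom A B → Hom A B
  zero : ∀ {A B : Obj}, Hom A B
  add_assoc : ∀ {A B : Obj} (f g h : Hom A B), add (add f g) h = add f (add g h)
  add_comm : ∀ {A B : Obj} (f g : Hom A B), add f g = add g f
  add_zero : ∀ {A B : Obj} (f : Hom A B), add f zero = f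
  comp_add : ∀ {A B C : Obj} (f : Hom A B) (g h : Hom B C),
    comp f (add g h) = add (comp f g) (comp f h)
  add_comp : ∀ {A B C : Obj} (f g : Hom A B) (h : Hom B C),
    comp (add f g) h = add (comp f h) (comp g h)
  comp_zero : ∀ {A B C : Obj} (f : Hom A B), comp f (zero : Hom B C) = zero
  zero_comp : ∀ {A B C : Obj} (f : Hom B C), comp (zero : Hom A B) f = zero
  tHom_add_left : ∀ {A B C D : Obj} (f g : Hom A C) (h : Hom B D),
    tHom (add f g) h = add (tHom f h) (tHom g h)
  tHom_add_right : ∀ {A B C D : Obj} (f : Hom A C) (g h : Hom B D),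
    tHom f (add g h) = add (tHom f g) (tHom f h)
  tHom_zero_left : ∀ {A B C D : Obj} (h : Hom B D),
    tHom (zero : Hom A C) h = zero
  tHom_zero_right : ∀ {A B C D : Obj} (f : Hom A C),
    tHom f (zero : Hom B D) = zero
  -- a coalgebra modality: a comonad (bang, rho, eps) with natural
  -- cocommutative comonoid structure (cmul, cunit) on each bang A,
  -- for which each rho A is a comonoid morphism
  bang : Obj → Obj
  bangMap : ∀ {A B : Obj}, Hom A B → Hom (bang A) (bang B)
  bangMap_id : ∀ (A : Obj), bangMap (id A) = id (bang A)
  bangMap_comp : ∀ {A B C : Obj} (f : Hom A B) (g : Hom B C),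
    bangMap (comp f g) = comp (bangMap f) (bangMap g)
  rho : ∀ (A : Obj), Hom (bang A) (bang (bang A))
  eps : ∀ (A : Obj), Hom (bang A) A
  cmul : ∀ (A : Obj), Hom (bang A) (ten (bang A) (bang A))
  cunit : ∀ (A : Obj), Hom (bang A) unit
  rho_natural : ∀ {A B : Obj} (f : Hom A B),
    comp (bangMap f) (rho B) = comp (rho A) (bangMap (bangMap f))
  eps_natural : ∀ {A B : Obj} (f : Hom A B),
    comp (bangMap f) (eps B) = comp (eps A) f
  cmul_natural : ∀ {A B : Obj} (f : Hom A B),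
    comp (bangMap f) (cmul B) = comp (cmul A) (tHom (bangMap f) (bangMap f))
  cunit_natural : ∀ {A B : Obj} (f : Hom A B),
    comp (bangMap f) (cunit B) = cunit A
  rho_eps : ∀ (A : Obj), comp (rho A) (eps (bang A)) = id (bang A)
  rho_bangMap_eps : ∀ (A : Obj), comp (rho A) (bangMap (eps A)) = id (bang A)
  rho_rho : ∀ (A : Obj), comp (rho A) (rho (bang A)) = comp (rho A) (bangMap (rho A))
  cmul_coassoc : ∀ (A : Obj),
    comp (cmul A) (comp (tHom (cmul A) (id (bang A)))
      (toSMCData.cHom (tenAssoc (bang A) (bang A) (bang A)))) =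
    comp (cmul A) (tHom (id (bang A)) (cmul A))
  cmul_counit_left : ∀ (A : Obj),
    comp (cmul A) (comp (tHom (cunit A) (id (bang A)))
      (toSMCData.cHom (unit_ten (bang A)))) = id (bang A)
  cmul_counit_right : ∀ (A : Obj),
    comp (cmul A) (comp (tHom (id (bang A)) (cunit A))
      (toSMCData.cHom (ten_unit (bang A)))) = id (bang A)
  cmul_cocomm : ∀ (A : Obj), comp (cmul A) (sw (bang A) (bang A)) = cmul A
  rho_cmul : ∀ (A : Obj),
    comp (rho A) (cmul (bang A)) = comp (cmul A) (tHom (rho A) (rho A))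
  rho_cunit : ∀ (A : Obj), comp (rho A) (cunit (bang A)) = cunit A
  -- a deriving transformation [d.1]-[d.5]
  der : ∀ (A : Obj), Hom (ten (bang A) A) (bang A)
  der_natural : ∀ {A B : Obj} (f : Hom A B),
    comp (tHom (bangMap f) f) (der B) = comp (der A) (bangMap f)
  -- [d.1] constant rule
  der_cunit : ∀ (A : Obj), comp (der A) (cunit A) = zero
  -- [d.2] Leibniz rule
  der_cmul : ∀ (A : Obj),
    comp (der A) (cmul A) =
      add
        (comp (tHom (cmul A) (id A))
          (comp (toSMCData.cHom (tenAssoc (bang A) (bang A) A))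
            (comp (tHom (id (bang A)) (sw (bang A) A))
              (comp (toSMCData.cHom (tenAssoc (bang A) A (bang A)).symm)
                (tHom (der A) (id (bang A)))))))
        (comp (tHom (cmul A) (id A))
          (comp (toSMCData.cHom (tenAssoc (bang A) (bang A) A))
            (tHom (id (bang A)) (der A))))
  -- [d.3] linear rule
  der_eps : ∀ (A : Obj),
    comp (der A) (eps A) = comp (tHom (cunit A) (id A)) (toSMCData.cHom (unit_ten A))
  -- [d.4] chain rule
  der_rho : ∀ (A : Obj),
    comp (der A) (rho A) =
      comp (tHom (cmul A) (id A))
        (comp (toSMCData.cHom (tenAssoc (bang A) (bang A) A))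
          (comp (tHom (rho A) (der A)) (der (bang A))))
  -- [d.5] interchange rule
  der_interchange : ∀ (A : Obj),
    comp (tHom (der A) (id A)) (der A) =
      comp (toSMCData.cHom (tenAssoc (bang A) A A))
        (comp (tHom (id (bang A)) (sw A A))
          (comp (toSMCData.cHom (tenAssoc (bang A) A A).symm)
            (comp (tHom (der A) (id A)) (der A))))
  -- monoidal coalgebra modality structure: (bang, m, mUnit) is a symmetric
  -- monoidal functor, rho, eps, cmul, cunit are monoidal transformations and
  -- cmul, cunit are bang-coalgebra morphisms
  m : ∀ (A B : Obj), Hom (ten (bang A) (bang B)) (bang (ten A B))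
  mUnit : Hom unit (bang unit)
  m_natural : ∀ {A A' B B' : Obj} (f : Hom A A') (g : Hom B B'),
    comp (tHom (bangMap f) (bangMap g)) (m A' B') = comp (m A B) (bangMap (tHom f g))
  m_assoc : ∀ (A B C : Obj),
    comp (tHom (m A B) (id (bang C)))
      (comp (m (ten A B) C) (bangMap (toSMCData.cHom (tenAssoc A B C)))) =
    comp (toSMCData.cHom (tenAssoc (bang A) (bang B) (bang C)))
      (comp (tHom (id (bang A)) (m B C)) (m A (ten B C)))
  m_unit_left : ∀ (A : Obj),
    comp (toSMCData.cHom (unit_ten (bang A)).symm)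
      (comp (tHom mUnit (id (bang A)))
        (comp (m unit A) (bangMap (toSMCData.cHom (unit_ten A))))) = id (bang A)
  m_unit_right : ∀ (A : Obj),
    comp (toSMCData.cHom (ten_unit (bang A)).symm)
      (comp (tHom (id (bang A)) mUnit)
        (comp (m A unit) (bangMap (toSMCData.cHom (ten_unit A))))) = id (bang A)
  m_sw : ∀ (A B : Obj),
    comp (sw (bang A) (bang B)) (m B A) = comp (m A B) (bangMap (sw A B))
  m_rho : ∀ (A B : Obj),
    comp (m A B) (rho (ten A B)) =
      comp (tHom (rho A) (rho B)) (comp (m (bang A) (bang B)) (bangMap (m A B)))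
  mUnit_rho : comp mUnit (rho unit) = comp mUnit (bangMap mUnit)
  m_eps : ∀ (A B : Obj), comp (m A B) (eps (ten A B)) = tHom (eps A) (eps B)
  mUnit_eps : comp mUnit (eps unit) = id unit
  m_cmul : ∀ (A B : Obj),
    comp (m A B) (cmul (ten A B)) =
      comp (tHom (cmul A) (cmul B))
        (comp (toSMCData.cHom (tenAssoc (bang A) (bang A) (ten (bang B) (bang B))))
          (comp (tHom (id (bang A)) (toSMCData.cHom (tenAssoc (bang A) (bang B) (bang B)).symm))
            (comp (tHom (id (bang A)) (tHom (sw (bang A) (bang B)) (id (bang B))))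
              (comp (tHom (id (bang A)) (toSMCData.cHom (tenAssoc (bang B) (bang A) (bang B))))
                (comp (toSMCData.cHom (tenAssoc (bang A) (bang B) (ten (bang A) (bang B))).symm)
                  (tHom (m A B) (m A B)))))))
  m_cunit : ∀ (A B : Obj),
    comp (m A B) (cunit (ten A B)) =
      comp (tHom (cunit A) (cunit B)) (toSMCData.cHom (unit_ten unit))
  mUnit_cmul : comp mUnit (cmul unit) =
    comp (toSMCData.cHom (unit_ten unit).symm) (tHom mUnit mUnit)
  mUnit_cunit : comp mUnit (cunit unit) = id unit
  cmul_coalg : ∀ (A : Obj),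
    comp (rho A) (bangMap (cmul A)) =
      comp (cmul A) (comp (tHom (rho A) (rho A)) (m (bang A) (bang A)))
  cunit_coalg : ∀ (A : Obj),
    comp (rho A) (bangMap (cunit A)) = comp (cunit A) mUnit

def DiffLinCat.cHom (C : DiffLinCat) {A B : C.Obj} (h : A = B) : C.Hom A B :=
  C.toSMCData.cHom h

namespace DiffLinCat

variable (C : DiffLinCat)

/-- The coderiving transformation d°_A := Δ_A (1 ⊗ ε_A). -/
def dcirc (A : C.Obj) : C.Hom (C.bang A) (C.ten (C.bang A) A) :=
  C.comp (C.cmul A) (C.tHom (C.id (C.bang A)) (C.eps A))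

/-- K_A := d°_A d_A + !(0). -/
def K (A : C.Obj) : C.Hom (C.bang A) (C.bang A) :=
  C.add (C.comp (C.dcirc A) (C.der A)) (C.bangMap (C.zero : C.Hom A A))

/-- J_A := d°_A d_A + 1_{!A}. -/
def J (A : C.Obj) : C.Hom (C.bang A) (C.bang A) :=
  C.add (C.comp (C.dcirc A) (C.der A)) (C.id (C.bang A))

/-- The deriving transformation at the monoidal unit, under the strictness
identification !R ⊗ R = !R. -/
def dR : C.Hom (C.bang C.unit) (C.bang C.unit) :=
  C.comp (C.cHom (C.ten_unit (C.bang C.unit)).symm) (C.der C.unit)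

/-- The coderiving transformation at the monoidal unit, under the strictness
identification !R ⊗ R = !R. -/
def dcircR : C.Hom (C.bang C.unit) (C.bang C.unit) :=
  C.comp (C.dcirc C.unit) (C.cHom (C.ten_unit (C.bang C.unit)))

end DiffLinCat

namespace DiffLinCat

open CategoryTheory MonoidalCategory

/-! ### The symmetric monoidal category underlying a differential linear category -/

section Structural

variable {C : DiffLinCat}

theorem cHom_comp_cHom {X Y Z : C.Obj} (h : X = Y) (k : Y = Z) :
    C.comp (C.toSMCData.cHom h) (C.toSMCData.cHom k) = C.toSMCData.cHom (h.trans k) := by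
  subst h k
  exact C.id_comp _

theorem tHom_cHom_cHom {X Y X' Y' : C.Obj} (h : X = Y) (k : X' = Y') :
    C.tHom (C.toSMCData.cHom h) (C.toSMCData.cHom k) =
      C.toSMCData.cHom (congrArg₂ C.ten h k) := by
  subst h k
  exact C.tHom_id _ _

theorem tHom_id_cHom (W : C.Obj) {X Y : C.Obj} (h : X = Y) :
    C.tHom (C.id W) (C.toSMCData.cHom h) = C.toSMCData.cHom (congrArg (C.ten W) h) :=
  tHom_cHom_cHom rfl h

theorem tHom_cHom_id {X Y : C.Obj} (h : X = Y) (W : C.Obj) :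
    C.tHom (C.toSMCData.cHom h) (C.id W) =
      C.toSMCData.cHom (congrArg (fun Z => C.ten Z W) h) :=
  tHom_cHom_cHom h rfl

instance : Category C.Obj where
  Hom := C.Hom
  id := C.id
  comp := C.comp
  id_comp := C.id_comp
  comp_id := C.comp_id
  assoc := C.comp_assoc

/-- The isomorphism given by an equality of objects. -/
def cIso {X Y : C.Obj} (h : X = Y) : X ≅ Y where
  hom := C.toSMCData.cHom h
  inv := C.toSMCData.cHom h.symm
  hom_inv_id := cHom_comp_cHom h h.symm
  inv_hom_id := cHom_comp_cHom h.symm h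

instance : MonoidalCategoryStruct C.Obj where
  tensorObj := C.ten
  tensorUnit := C.unit
  tensorHom := C.tHom
  whiskerLeft X _ _ f := C.tHom (C.id X) f
  whiskerRight f Y := C.tHom f (C.id Y)
  associator X Y Z := cIso (C.tenAssoc X Y Z)
  leftUnitor X := cIso (C.unit_ten X)
  rightUnitor X := cIso (C.ten_unit X)

instance : MonoidalCategory C.Obj :=
  MonoidalCategory.ofTensorHom
    (id_tensorHom_id := C.tHom_id)
    (id_tensorHom := fun _ _ _ _ => rfl)
    (tensorHom_id := fun _ _ => rfl)
    (tensorHom_comp_tensorHom := fun f₁ f₂ g₁ g₂ => (C.tHom_comp f₁ g₁ f₂ g₂).symm)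
    (associator_naturality := C.assoc_natural)
    (leftUnitor_naturality := C.unit_ten_natural)
    (rightUnitor_naturality := C.ten_unit_natural)
    (pentagon := fun W X Y Z => by
      change C.comp (C.tHom (C.toSMCData.cHom _) (C.id Z))
          (C.comp (C.toSMCData.cHom _) (C.tHom (C.id W) (C.toSMCData.cHom _))) =
        C.comp (C.toSMCData.cHom _) (C.toSMCData.cHom _)
      rw [tHom_cHom_id, tHom_id_cHom, cHom_comp_cHom, cHom_comp_cHom, cHom_comp_cHom])
    (triangle := fun X Y => by
      change C.comp (C.toSMCData.cHom _) (C.tHom (C.id X) (C.toSMCData.cHom _)) =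
        C.tHom (C.toSMCData.cHom _) (C.id Y)
      rw [tHom_cHom_id, tHom_id_cHom, cHom_comp_cHom])

/-- The symmetry isomorphism. -/
def swIso (X Y : C.Obj) : X ⊗ Y ≅ Y ⊗ X where
  hom := C.sw X Y
  inv := C.sw Y X
  hom_inv_id := C.sw_sw X Y
  inv_hom_id := C.sw_sw Y X

theorem swIso_hexagon (X Y Z : C.Obj) :
    (α_ X Y Z).inv ≫ (swIso (X ⊗ Y) Z).hom ≫ (α_ Z X Y).inv =
      (X ◁ (swIso Y Z).hom) ≫ (α_ X Z Y).inv ≫ ((swIso X Z).hom ▷ Y) := by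
  have h : (α_ X Y Z).hom ≫ X ◁ (swIso Y Z).hom ≫ (α_ X Z Y).inv ≫
      (swIso X Z).hom ▷ Y ≫ (α_ Z X Y).hom = (swIso (X ⊗ Y) Z).hom := C.hexagon X Y Z
  simp [← h]

instance : SymmetricCategory C.Obj where
  braiding := swIso
  braiding_naturality_right X _ _ f := C.sw_natural (C.id X) f
  braiding_naturality_left f Z := C.sw_natural f (C.id Z)
  hexagon_forward X Y Z := by
    have h := swIso_hexagon Y Z X
    have h' := congrArg (fun (i : _ ≅ _) => i.inv)
      (show (α_ Y Z X).symm ≪≫ swIso (Y ⊗ Z) X ≪≫ (α_ X Y Z).symm =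
        whiskerLeftIso Y (swIso Z X) ≪≫ (α_ Y X Z).symm ≪≫ whiskerRightIso (swIso Y X) Z from
        Iso.ext h)
    simp only [Iso.trans_inv, Iso.symm_inv, whiskerLeftIso_inv, whiskerRightIso_inv,
      Category.assoc] at h'
    exact h'
  hexagon_reverse := swIso_hexagon
  symmetry := C.sw_sw

instance {X Y : C.Obj} : Add (X ⟶ Y) := ⟨C.add⟩

instance {X Y : C.Obj} : Zero (X ⟶ Y) := ⟨C.zero⟩

theorem hom_zero_add {X Y : C.Obj} (f : X ⟶ Y) : 0 + f = f :=
  (C.add_comm _ f).trans (C.add_zero f)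

theorem hom_comp_add {X Y Z : C.Obj} (f : X ⟶ Y) (g h : Y ⟶ Z) :
    f ≫ (g + h) = f ≫ g + f ≫ h := C.comp_add f g h

theorem hom_add_comp {X Y Z : C.Obj} (f g : X ⟶ Y) (h : Y ⟶ Z) :
    (f + g) ≫ h = f ≫ h + g ≫ h := C.add_comp f g h

theorem hom_comp_zero {X Y : C.Obj} (f : X ⟶ Y) (Z : C.Obj) : f ≫ (0 : Y ⟶ Z) = 0 :=
  C.comp_zero f

theorem hom_zero_comp (X : C.Obj) {Y Z : C.Obj} (f : Y ⟶ Z) : (0 : X ⟶ Y) ≫ f = 0 :=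
  C.zero_comp f

theorem whiskerLeft_hom_add (W : C.Obj) {X Y : C.Obj} (f g : X ⟶ Y) :
    W ◁ (f + g) = W ◁ f + W ◁ g := C.tHom_add_right (C.id W) f g

theorem zero_tensorHom {X Y X' Y' : C.Obj} (f : X' ⟶ Y') : (0 : X ⟶ Y) ⊗ₘ f = 0 :=
  C.tHom_zero_left f

theorem tensorHom_zero {X Y X' Y' : C.Obj} (f : X' ⟶ Y') : f ⊗ₘ (0 : X ⟶ Y) = 0 :=
  C.tHom_zero_right f

end Structural

/-! ### The structure maps as morphisms of the underlying category -/

section StructureMaps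

variable {C : DiffLinCat}

/-- The functor underlying the coalgebra modality. -/
def oc (C : DiffLinCat) : C.Obj ⥤ C.Obj where
  obj := C.bang
  map := C.bangMap
  map_id := C.bangMap_id
  map_comp := C.bangMap_comp

/-- The comultiplication of the comonad. -/
def dig (X : C.Obj) : C.oc.obj X ⟶ C.oc.obj (C.oc.obj X) := C.rho X

/-- The counit of the comonad. -/
def derel (X : C.Obj) : C.oc.obj X ⟶ X := C.eps X

/-- The comultiplication of the comonoid `!X`. -/
def dup (X : C.Obj) : C.oc.obj X ⟶ C.oc.obj X ⊗ C.oc.obj X := C.cmul X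

/-- The counit of the comonoid `!X`. -/
def del (X : C.Obj) : C.oc.obj X ⟶ 𝟙_ C.Obj := C.cunit X

/-- The deriving transformation. -/
def deriv (X : C.Obj) : C.oc.obj X ⊗ X ⟶ C.oc.obj X := C.der X

/-- The monoidal structure of `!`. -/
def lax (X Y : C.Obj) : C.oc.obj X ⊗ C.oc.obj Y ⟶ C.oc.obj (X ⊗ Y) := C.m X Y

/-- The monoidal unit map of `!`. -/
def laxUnit (C : DiffLinCat) : 𝟙_ C.Obj ⟶ C.oc.obj (𝟙_ C.Obj) := C.mUnit

theorem dig_naturality {X Y : C.Obj} (f : X ⟶ Y) :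
    C.oc.map f ≫ dig Y = dig X ≫ C.oc.map (C.oc.map f) := C.rho_natural f

theorem derel_naturality {X Y : C.Obj} (f : X ⟶ Y) :
    C.oc.map f ≫ derel Y = derel X ≫ f := C.eps_natural f

theorem dup_naturality {X Y : C.Obj} (f : X ⟶ Y) :
    C.oc.map f ≫ dup Y = dup X ≫ (C.oc.map f ⊗ₘ C.oc.map f) := C.cmul_natural f

theorem del_naturality {X Y : C.Obj} (f : X ⟶ Y) : C.oc.map f ≫ del Y = del X :=
  C.cunit_natural f

theorem deriv_naturality {X Y : C.Obj} (f : X ⟶ Y) :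
    (C.oc.map f ⊗ₘ f) ≫ deriv Y = deriv X ≫ C.oc.map f := C.der_natural f

theorem lax_naturality {X X' Y Y' : C.Obj} (f : X ⟶ X') (g : Y ⟶ Y') :
    (C.oc.map f ⊗ₘ C.oc.map g) ≫ lax X' Y' = lax X Y ≫ C.oc.map (f ⊗ₘ g) := C.m_natural f g

theorem dig_map_derel (X : C.Obj) : dig X ≫ C.oc.map (derel X) = 𝟙 _ := C.rho_bangMap_eps X

theorem dup_coassoc (X : C.Obj) :
    dup X ≫ dup X ▷ C.oc.obj X ≫ (α_ _ _ _).hom = dup X ≫ C.oc.obj X ◁ dup X := C.cmul_coassoc X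

theorem dup_del_left (X : C.Obj) : dup X ≫ del X ▷ C.oc.obj X ≫ (λ_ _).hom = 𝟙 _ :=
  C.cmul_counit_left X

theorem dup_del_right (X : C.Obj) : dup X ≫ C.oc.obj X ◁ del X ≫ (ρ_ _).hom = 𝟙 _ :=
  C.cmul_counit_right X

theorem dup_braiding (X : C.Obj) : dup X ≫ (β_ _ _).hom = dup X := C.cmul_cocomm X

theorem dig_dup (X : C.Obj) : dig X ≫ dup (C.oc.obj X) = dup X ≫ (dig X ⊗ₘ dig X) := C.rho_cmul X

theorem deriv_dup (X : C.Obj) :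
    deriv X ≫ dup X =
      dup X ▷ X ≫ (α_ _ _ _).hom ≫ C.oc.obj X ◁ (β_ _ _).hom ≫ (α_ _ _ _).inv ≫
        deriv X ▷ C.oc.obj X +
        dup X ▷ X ≫ (α_ _ _ _).hom ≫ C.oc.obj X ◁ deriv X := C.der_cmul X

theorem deriv_derel (X : C.Obj) : deriv X ≫ derel X = del X ▷ X ≫ (λ_ X).hom := C.der_eps X

theorem deriv_dig (X : C.Obj) :
    deriv X ≫ dig X =
      dup X ▷ X ≫ (α_ _ _ _).hom ≫ (dig X ⊗ₘ deriv X) ≫ deriv (C.oc.obj X) := C.der_rho X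

theorem laxUnit_lax (X : C.Obj) :
    (λ_ _).inv ≫ laxUnit C ▷ C.oc.obj X ≫ lax (𝟙_ _) X ≫ C.oc.map (λ_ X).hom = 𝟙 _ :=
  C.m_unit_left X

theorem lax_laxUnit (X : C.Obj) :
    (ρ_ _).inv ≫ C.oc.obj X ◁ laxUnit C ≫ lax X (𝟙_ _) ≫ C.oc.map (ρ_ X).hom = 𝟙 _ :=
  C.m_unit_right X

theorem braiding_lax (X Y : C.Obj) :
    (β_ _ _).hom ≫ lax Y X = lax X Y ≫ C.oc.map (β_ X Y).hom := C.m_sw X Y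

theorem lax_derel (X Y : C.Obj) : lax X Y ≫ derel (X ⊗ Y) = derel X ⊗ₘ derel Y := C.m_eps X Y

theorem lax_dup (X Y : C.Obj) :
    lax X Y ≫ dup (X ⊗ Y) = (dup X ⊗ₘ dup Y) ≫ tensorμ _ _ _ _ ≫ (lax X Y ⊗ₘ lax X Y) := by
  simp only [tensorμ, Category.assoc]
  exact C.m_cmul X Y

theorem dig_map_dup (X : C.Obj) :
    dig X ≫ C.oc.map (dup X) = dup X ≫ (dig X ⊗ₘ dig X) ≫ lax _ _ := C.cmul_coalg X

theorem dig_map_del (X : C.Obj) : dig X ≫ C.oc.map (del X) = del X ≫ laxUnit C := C.cunit_coalg X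

end StructureMaps

/-! ### Coderivations induced by vector fields -/

section Flow

variable {C : DiffLinCat}

/-- The coderivation of `!X` induced by a map `v : !X ⟶ X`. -/
def flow {X : C.Obj} (v : C.oc.obj X ⟶ X) : C.oc.obj X ⟶ C.oc.obj X :=
  dup X ≫ C.oc.obj X ◁ v ≫ deriv X

/-- The map `d° d`. -/
def euler (X : C.Obj) : C.oc.obj X ⟶ C.oc.obj X := flow (derel X)

theorem flow_dup {X : C.Obj} (v : C.oc.obj X ⟶ X) :
    flow v ≫ dup X = dup X ≫ flow v ▷ _ + dup X ≫ _ ◁ flow v := by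
  have assoc_comul : dup X ≫ C.oc.obj X ◁ v ≫ dup X ▷ X ≫ (α_ _ _ _).hom =
      dup X ≫ C.oc.obj X ◁ (dup X ≫ C.oc.obj X ◁ v) := by
    rw [whisker_exchange_assoc, whiskerLeft_comp, ← reassoc_of% (dup_coassoc X)]
    simp
  have cocomm : dup X ≫ C.oc.obj X ◁ v ≫ (β_ _ _).hom = dup X ≫ v ▷ C.oc.obj X := by
    rw [BraidedCategory.braiding_naturality_right, reassoc_of% (dup_braiding X)]
  have coassoc_inv : dup X ≫ C.oc.obj X ◁ dup X ≫ (α_ _ _ _).inv = dup X ≫ dup X ▷ _ := by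
    rw [← reassoc_of% (dup_coassoc X)]
    simp
  simp only [flow, Category.assoc, deriv_dup, hom_comp_add]
  congr 1
  · rw [reassoc_of% assoc_comul, ← whiskerLeft_comp_assoc, Category.assoc, cocomm,
      whiskerLeft_comp_assoc]
    simp only [comp_whiskerRight, ← reassoc_of% coassoc_inv]
    simp
  · rw [reassoc_of% assoc_comul]
    simp

theorem flow_map {X Y : C.Obj} {v : C.oc.obj X ⟶ X} (f : X ⟶ Y) :
    flow v ≫ C.oc.map f = dup X ≫ (C.oc.map f ⊗ₘ (v ≫ f)) ≫ deriv Y := by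
  simp only [flow, Category.assoc, ← deriv_naturality]
  simp [tensorHom_def']

theorem flow_map_of_comm {X Y : C.Obj} {v : C.oc.obj X ⟶ X} {w : C.oc.obj Y ⟶ Y} {f : X ⟶ Y}
    (h : v ≫ f = C.oc.map f ≫ w) : flow v ≫ C.oc.map f = C.oc.map f ≫ flow w := by
  rw [flow_map, h, flow, reassoc_of% (dup_naturality f)]
  simp [MonoidalCategory.tensorHom_def]

theorem flow_map_eq_zero {X Y : C.Obj} {v : C.oc.obj X ⟶ X} {f : X ⟶ Y} (h : v ≫ f = 0) :
    flow v ≫ C.oc.map f = 0 := by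
  rw [flow_map, h, tensorHom_zero, hom_zero_comp, hom_comp_zero]

theorem flow_derel {X : C.Obj} (v : C.oc.obj X ⟶ X) : flow v ≫ derel X = v := by
  simp only [flow, Category.assoc, deriv_derel]
  rw [whisker_exchange_assoc, leftUnitor_naturality, reassoc_of% (dup_del_left X)]

theorem flow_dig {X : C.Obj} (v : C.oc.obj X ⟶ X) :
    flow v ≫ dig X = dup X ≫ (dig X ⊗ₘ flow v) ≫ deriv _ := by
  simp only [flow, Category.assoc, deriv_dig]
  rw [whisker_exchange_assoc]
  simp only [tensorHom_def', whiskerLeft_comp, Category.assoc,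
    ← reassoc_of% (dup_coassoc X)]
  simp

end Flow

/-! ### Compatibility of `K` with the monoidal structure -/

section Monoidal

variable {C : DiffLinCat} (X Y : C.Obj)

/-- The coalgebra structure of `!X ⊗ !Y`. -/
def tensorDig : C.oc.obj X ⊗ C.oc.obj Y ⟶ C.oc.obj (C.oc.obj X ⊗ C.oc.obj Y) :=
  (dig X ⊗ₘ dig Y) ≫ lax _ _

/-- The first projection `!X ⊗ !Y ⟶ X`. -/
def projFst : C.oc.obj X ⊗ C.oc.obj Y ⟶ X := (derel X ⊗ₘ del Y) ≫ (ρ_ X).hom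

/-- The second projection `!X ⊗ !Y ⟶ Y`. -/
def projSnd : C.oc.obj X ⊗ C.oc.obj Y ⟶ Y := (del X ⊗ₘ derel Y) ≫ (λ_ Y).hom

/-- The map `!(!X ⊗ !Y) ⟶ !X ⊗ !Y` induced by the two projections. -/
def split : C.oc.obj (C.oc.obj X ⊗ C.oc.obj Y) ⟶ C.oc.obj X ⊗ C.oc.obj Y :=
  dup _ ≫ (C.oc.map (projFst X Y) ⊗ₘ C.oc.map (projSnd X Y))

theorem tensorDig_map_projFst :
    tensorDig X Y ≫ C.oc.map (projFst X Y) = C.oc.obj X ◁ del Y ≫ (ρ_ _).hom := by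
  simp only [tensorDig, projFst, Functor.map_comp, Category.assoc]
  rw [← reassoc_of% (lax_naturality (derel X) (del Y)), tensorHom_comp_tensorHom_assoc,
    dig_map_derel, dig_map_del, id_tensorHom, whiskerLeft_comp_assoc,
    (Iso.inv_comp_eq _).1 (lax_laxUnit X), Category.comp_id]

theorem tensorDig_map_projSnd :
    tensorDig X Y ≫ C.oc.map (projSnd X Y) = del X ▷ C.oc.obj Y ≫ (λ_ _).hom := by
  simp only [tensorDig, projSnd, Functor.map_comp, Category.assoc]
  rw [← reassoc_of% (lax_naturality (del X) (derel Y)), tensorHom_comp_tensorHom_assoc,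
    dig_map_derel, dig_map_del, tensorHom_id, comp_whiskerRight_assoc,
    (Iso.inv_comp_eq _).1 (laxUnit_lax Y), Category.comp_id]

theorem tensorDig_dup :
    tensorDig X Y ≫ dup _ =
      (dup X ⊗ₘ dup Y) ≫ tensorμ _ _ _ _ ≫ (tensorDig X Y ⊗ₘ tensorDig X Y) := by
  simp only [tensorDig, Category.assoc, lax_dup]
  rw [tensorHom_comp_tensorHom_assoc, dig_dup, dig_dup, ← tensorHom_comp_tensorHom_assoc,
    reassoc_of% (tensorμ_natural (dig X) (dig X) (dig Y) (dig Y)), tensorHom_comp_tensorHom]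

theorem tensorμ_unit_unit (A B : C.Obj) :
    tensorμ A (𝟙_ _) (𝟙_ _) B ≫ ((ρ_ A).hom ⊗ₘ (λ_ B).hom) = (ρ_ A).hom ⊗ₘ (λ_ B).hom := by
  simp only [tensorμ, braiding_tensorUnit_left]
  monoidal

theorem tensorDig_split : tensorDig X Y ≫ split X Y = 𝟙 _ := by
  rw [split, reassoc_of% (tensorDig_dup X Y), tensorHom_comp_tensorHom,
    tensorDig_map_projFst, tensorDig_map_projSnd, ← tensorHom_comp_tensorHom,
    ← id_tensorHom, ← tensorHom_id,
    ← reassoc_of% (tensorμ_natural (𝟙 (C.oc.obj X)) (del X) (del Y) (𝟙 (C.oc.obj Y))),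
    tensorμ_unit_unit, tensorHom_comp_tensorHom, tensorHom_comp_tensorHom]
  simp [dup_del_left, dup_del_right]

theorem split_lax :
    split X Y ≫ lax X Y = dig _ ≫ C.oc.map (split X Y ≫ (derel X ⊗ₘ derel Y)) := by
  have h : lax X Y = (dig X ⊗ₘ dig Y) ≫ lax _ _ ≫ C.oc.map (derel X ⊗ₘ derel Y) := by
    rw [← lax_naturality, tensorHom_comp_tensorHom_assoc, dig_map_derel, dig_map_derel]
    simp
  conv_lhs => rw [h]
  simp only [split, Functor.map_comp, Category.assoc]
  rw [reassoc_of% (dig_map_dup (C.oc.obj X ⊗ C.oc.obj Y)), ← reassoc_of% lax_naturality,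
    tensorHom_comp_tensorHom_assoc, tensorHom_comp_tensorHom_assoc, dig_naturality, dig_naturality]

/-- The endomorphism of `!X ⊗ !Y` vanishing along the first projection and fixing the second. -/
def sndPart : C.oc.obj X ⊗ C.oc.obj Y ⟶ C.oc.obj X ⊗ C.oc.obj Y :=
  C.oc.map (0 : X ⟶ X) ▷ C.oc.obj Y

theorem sndPart_projFst : sndPart X Y ≫ projFst X Y = 0 := by
  rw [sndPart, projFst, ← tensorHom_id, tensorHom_comp_tensorHom_assoc, derel_naturality,
    hom_comp_zero, zero_tensorHom, hom_zero_comp]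

theorem sndPart_projSnd : sndPart X Y ≫ projSnd X Y = projSnd X Y := by
  rw [sndPart, projSnd, ← tensorHom_id, tensorHom_comp_tensorHom_assoc, del_naturality,
    Category.id_comp]

theorem flow_sndPart_split :
    flow (derel _ ≫ sndPart X Y) ≫ split X Y = split X Y ≫ C.oc.obj X ◁ euler Y := by
  have hFst : flow (derel _ ≫ sndPart X Y) ≫ C.oc.map (projFst X Y) = 0 :=
    flow_map_eq_zero (by rw [Category.assoc, sndPart_projFst, hom_comp_zero])
  have hSnd : flow (derel _ ≫ sndPart X Y) ≫ C.oc.map (projSnd X Y) =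
      C.oc.map (projSnd X Y) ≫ euler Y :=
    flow_map_of_comm (by rw [Category.assoc, sndPart_projSnd, derel_naturality])
  rw [split, reassoc_of% (flow_dup (derel _ ≫ sndPart X Y)), hom_add_comp, ← tensorHom_id,
    ← id_tensorHom, ← id_tensorHom]
  simp only [Category.assoc, tensorHom_comp_tensorHom, hFst, hSnd, zero_tensorHom, hom_comp_zero,
    hom_zero_add, Category.id_comp, Category.comp_id]

theorem whiskerLeft_euler_lax :
    C.oc.obj X ◁ euler Y ≫ lax X Y = lax X Y ≫ euler (X ⊗ Y) := by
  have comonoidHom : dup _ ≫ ((split X Y ≫ lax X Y) ⊗ₘ (split X Y ≫ lax X Y)) =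
      split X Y ≫ lax X Y ≫ dup _ := by
    rw [← Category.assoc (split X Y), split_lax, ← tensorHom_comp_tensorHom,
      ← reassoc_of% (dig_dup (C.oc.obj X ⊗ C.oc.obj Y)), ← dup_naturality, Category.assoc]
  have flow_split : flow (derel _ ≫ sndPart X Y) ≫ split X Y ≫ (derel X ⊗ₘ derel Y) =
      (split X Y ≫ lax X Y) ≫ derel _ := by
    rw [reassoc_of% (flow_sndPart_split X Y), Category.assoc, lax_derel, ← id_tensorHom,
      tensorHom_comp_tensorHom, euler, flow_derel, Category.id_comp]
  have h : split X Y ≫ C.oc.obj X ◁ euler Y ≫ lax X Y =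
      split X Y ≫ lax X Y ≫ euler (X ⊗ Y) := by
    rw [← reassoc_of% (flow_sndPart_split X Y), split_lax, reassoc_of% flow_dig,
      ← deriv_naturality, tensorHom_comp_tensorHom_assoc, ← split_lax, flow_split, euler, flow,
      ← reassoc_of% comonoidHom, ← id_tensorHom, tensorHom_comp_tensorHom_assoc, Category.comp_id]
  have := tensorDig X Y ≫= h
  rwa [reassoc_of% (tensorDig_split X Y), reassoc_of% (tensorDig_split X Y)] at this

/-- The natural transformation `K`. -/
def kMap : C.oc.obj X ⟶ C.oc.obj X := euler X + C.oc.map 0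

theorem kMap_eq_K : kMap X = C.K X :=
  congrArg (fun f => f + C.oc.map (0 : X ⟶ X)) (Category.assoc _ _ _).symm

theorem whiskerLeft_kMap_lax :
    C.oc.obj X ◁ kMap Y ≫ lax X Y = lax X Y ≫ kMap (X ⊗ Y) := by
  have h := lax_naturality (𝟙 X) (0 : Y ⟶ Y)
  rw [tensorHom_zero, CategoryTheory.Functor.map_id, id_tensorHom] at h
  rw [kMap, kMap, whiskerLeft_hom_add, hom_add_comp, hom_comp_add, whiskerLeft_euler_lax, h]

theorem kMap_naturality {A B : C.Obj} (f : A ⟶ B) :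
    C.oc.map f ≫ kMap B = kMap A ≫ C.oc.map f := by
  rw [kMap, kMap, hom_comp_add, hom_add_comp, ← Functor.map_comp, ← Functor.map_comp,
    hom_comp_zero, hom_zero_comp, euler, euler, flow_map_of_comm (derel_naturality f).symm]

theorem kMap_whiskerRight_lax :
    kMap X ▷ C.oc.obj Y ≫ lax X Y = lax X Y ≫ kMap (X ⊗ Y) := by
  rw [← cancel_mono (C.oc.map (β_ X Y).hom), Category.assoc, Category.assoc, ← braiding_lax,
    BraidedCategory.braiding_naturality_left_assoc, whiskerLeft_kMap_lax, ← kMap_naturality,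
    reassoc_of% braiding_lax]

/-- The action of an endomorphism of `!R` on `!Y`. -/
def unitAction (g : C.oc.obj (𝟙_ C.Obj) ⟶ C.oc.obj (𝟙_ C.Obj)) : C.oc.obj Y ⟶ C.oc.obj Y :=
  (λ_ _).inv ≫ laxUnit C ▷ C.oc.obj Y ≫ g ▷ C.oc.obj Y ≫ lax (𝟙_ _) Y ≫ C.oc.map (λ_ Y).hom

theorem unitAction_kMap (g : C.oc.obj (𝟙_ C.Obj) ⟶ C.oc.obj (𝟙_ C.Obj)) :
    unitAction Y g ≫ kMap Y = unitAction Y (g ≫ kMap (𝟙_ _)) := by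
  simp only [unitAction, Category.assoc, comp_whiskerRight, kMap_naturality]
  rw [reassoc_of% kMap_whiskerRight_lax]

theorem kMap_unitAction (g : C.oc.obj (𝟙_ C.Obj) ⟶ C.oc.obj (𝟙_ C.Obj)) :
    kMap Y ≫ unitAction Y g = unitAction Y g ≫ kMap Y := by
  simp only [unitAction, Category.assoc, kMap_naturality]
  rw [← reassoc_of% (whiskerLeft_kMap_lax (𝟙_ C.Obj) Y), leftUnitor_inv_naturality_assoc,
    whisker_exchange_assoc, whisker_exchange_assoc]

theorem unitAction_id : unitAction Y (𝟙 (C.oc.obj (𝟙_ C.Obj))) = 𝟙 _ := by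
  rw [unitAction, id_whiskerRight, Category.id_comp, laxUnit_lax]

theorem unitAction_inverse (g : C.oc.obj (𝟙_ C.Obj) ⟶ C.oc.obj (𝟙_ C.Obj))
    (hg : g ≫ kMap (𝟙_ _) = 𝟙 _) :
    kMap Y ≫ unitAction Y g = 𝟙 _ ∧ unitAction Y g ≫ kMap Y = 𝟙 _ := by
  rw [kMap_unitAction, unitAction_kMap, hg, unitAction_id]
  exact ⟨rfl, rfl⟩

end Monoidal

end DiffLinCat

/-- Proposition: a differential linear category has antiderivatives iff K_R
is an isomorphism; moreover K_A⁻¹ = (m_R ⊗ 1_{!A})(K_R⁻¹ ⊗ 1_{!A}) m_{R,A}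
(written with the strictness identification R ⊗ !A = !A and !(R ⊗ A) = !A). -/
theorem statement9 (C : DiffLinCat) :
    ((∀ A : C.Obj, ∃ g : C.Hom (C.bang A) (C.bang A),
        C.comp (C.K A) g = C.id (C.bang A) ∧ C.comp g (C.K A) = C.id (C.bang A)) ↔
      (∃ g : C.Hom (C.bang C.unit) (C.bang C.unit),
        C.comp (C.K C.unit) g = C.id (C.bang C.unit) ∧
          C.comp g (C.K C.unit) = C.id (C.bang C.unit))) ∧
    (∀ KRinv : C.Hom (C.bang C.unit) (C.bang C.unit),
      C.comp (C.K C.unit) KRinv = C.id (C.bang C.unit) →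
      C.comp KRinv (C.K C.unit) = C.id (C.bang C.unit) →
      ∀ A : C.Obj,
        (C.comp (C.K A)
            (C.comp (C.cHom (C.unit_ten (C.bang A)).symm)
              (C.comp (C.tHom C.mUnit (C.id (C.bang A)))
                (C.comp (C.tHom KRinv (C.id (C.bang A)))
                  (C.comp (C.m C.unit A) (C.bangMap (C.cHom (C.unit_ten A))))))) =
          C.id (C.bang A)) ∧
        (C.comp
            (C.comp (C.cHom (C.unit_ten (C.bang A)).symm)
              (C.comp (C.tHom C.mUnit (C.id (C.bang A)))
                (C.comp (C.tHom KRinv (C.id (C.bang A)))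
                  (C.comp (C.m C.unit A) (C.bangMap (C.cHom (C.unit_ten A)))))))
            (C.K A) =
          C.id (C.bang A))) := by
  have inverse := fun (g : C.Hom (C.bang C.unit) (C.bang C.unit))
      (hg : C.comp g (C.K C.unit) = C.id (C.bang C.unit)) (A : C.Obj) =>
    DiffLinCat.kMap_eq_K A ▸ DiffLinCat.unitAction_inverse A g
      ((congrArg (C.comp g) (DiffLinCat.kMap_eq_K C.unit)).trans hg)
  exact ⟨⟨fun h => h C.unit, fun ⟨g, _, hg⟩ A => ⟨DiffLinCat.unitAction A g, inverse g hg A⟩⟩,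
    fun g _ hg A => inverse g hg A⟩
end

section
/- In a differential category, if a map s_R : !R → !R satisfies [ftc.2], then s_R J_R = d°_R (using the strictness identification !R ⊗ R = !R, so that d°_R : !R → !R). -/
universe u v

namespace SMCData

variable (C : SMCData)

/-- Transported identities are definitionally indifferent to the proof used, so a transport
along an equality of an object with itself is the identity. -/
theorem cHom_self {A : C.Obj} (h : A = A) : C.cHom h = C.id A := rfl

theorem cHom_cHom {A B D : C.Obj} (h : A = B) (k : B = D) :
    C.comp (C.cHom h) (C.cHom k) = C.cHom (h.trans k) := by
  subst h k
  exact C.id_comp _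

theorem cHom_cHom_assoc {A B D E : C.Obj} (h : A = B) (k : B = D) (f : C.Hom D E) :
    C.comp (C.cHom h) (C.comp (C.cHom k) f) = C.comp (C.cHom (h.trans k)) f := by
  rw [← C.comp_assoc, cHom_cHom]

theorem tHom_cHom {A A' B B' : C.Obj} (h : A = A') (k : B = B') :
    C.tHom (C.cHom h) (C.cHom k) = C.cHom (congrArg₂ C.ten h k) := by
  subst h k
  exact C.tHom_id _ _

theorem tHom_id_cHom (A : C.Obj) {B B' : C.Obj} (k : B = B') :
    C.tHom (C.id A) (C.cHom k) = C.cHom (congrArg (C.ten A) k) :=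
  C.tHom_cHom rfl k

theorem tHom_id_comp (A : C.Obj) {B B' B'' : C.Obj} (f : C.Hom B B') (g : C.Hom B' B'') :
    C.tHom (C.id A) (C.comp f g) = C.comp (C.tHom (C.id A) f) (C.tHom (C.id A) g) := by
  rw [← C.tHom_comp, C.id_comp]

theorem cHom_comp_cancel {A B D : C.Obj} (h : A = B) {f g : C.Hom B D}
    (e : C.comp (C.cHom h) f = C.comp (C.cHom h) g) : f = g := by
  subst h
  simpa only [cHom_self, C.id_comp] using e

theorem comp_cHom_cancel {A B D : C.Obj} (h : B = D) {f g : C.Hom A B}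
    (e : C.comp f (C.cHom h) = C.comp g (C.cHom h)) : f = g := by
  subst h
  simpa only [cHom_self, C.comp_id] using e

theorem sw_cHom {A A' : C.Obj} (h : A = A') (B : C.Obj) :
    C.sw A B = C.comp (C.cHom (congrArg (C.ten · B) h))
      (C.comp (C.sw A' B) (C.cHom (congrArg (C.ten B) h.symm))) := by
  subst h
  simp only [cHom_self, C.id_comp, C.comp_id]

theorem tHom_id_left_cHom {A A' B B' : C.Obj} (h : A = A') (f : C.Hom B B') :
    C.tHom (C.id A) f = C.comp (C.cHom (congrArg (C.ten · B) h))
      (C.comp (C.tHom (C.id A') f) (C.cHom (congrArg (C.ten · B') h.symm))) := by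
  subst h
  simp only [cHom_self, C.id_comp, C.comp_id]

end SMCData

namespace DiffCat

variable (C : DiffCat)

theorem unit_tHom {A B : C.Obj} (f : C.Hom A B) :
    C.tHom (C.id C.unit) f = C.comp (C.toSMCData.cHom (C.unit_ten A))
      (C.comp f (C.toSMCData.cHom (C.unit_ten B).symm)) := by
  apply C.comp_cHom_cancel (C.unit_ten B)
  simp only [C.unit_ten_natural, C.comp_assoc, SMCData.cHom_cHom, SMCData.cHom_self, C.comp_id]

theorem tHom_unit {A B : C.Obj} (f : C.Hom A B) :
    C.tHom f (C.id C.unit) = C.comp (C.toSMCData.cHom (C.ten_unit A))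
      (C.comp f (C.toSMCData.cHom (C.ten_unit B).symm)) := by
  apply C.comp_cHom_cancel (C.ten_unit B)
  simp only [C.ten_unit_natural, C.comp_assoc, SMCData.cHom_cHom, SMCData.cHom_self, C.comp_id]

/-- The symmetry with the monoidal unit is the strictness identification. -/
theorem sw_unit_left (A : C.Obj) :
    C.sw C.unit A = C.toSMCData.cHom ((C.unit_ten A).trans (C.ten_unit A).symm) := by
  have hex := C.hexagon C.unit C.unit A
  rw [C.sw_cHom (C.unit_ten C.unit) A, unit_tHom, tHom_unit] at hex
  simp only [C.comp_assoc, SMCData.cHom_cHom, SMCData.cHom_cHom_assoc] at hex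
  have idem := C.cHom_comp_cancel _ hex
  simp only [← C.comp_assoc] at idem
  have idem' := C.comp_cHom_cancel _ idem
  have cancel := congrArg (fun f => C.comp f (C.sw A C.unit)) idem'
  simp only [C.comp_assoc, C.sw_sw, C.comp_id] at cancel
  have key := congrArg (fun f => C.comp f (C.toSMCData.cHom
    ((C.unit_ten A).trans (C.ten_unit A).symm))) cancel
  simpa only [C.comp_assoc, SMCData.cHom_cHom, SMCData.cHom_self, C.comp_id, C.id_comp] using key

theorem sw_unit_right (A : C.Obj) :
    C.sw A C.unit = C.toSMCData.cHom ((C.ten_unit A).trans (C.unit_ten A).symm) := by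
  apply C.cHom_comp_cancel ((C.unit_ten A).trans (C.ten_unit A).symm)
  rw [← sw_unit_left, C.sw_sw, sw_unit_left, SMCData.cHom_cHom, SMCData.cHom_self]

theorem cmul_tHom_cunit (A : C.Obj) :
    C.comp (C.cmul A) (C.tHom (C.id (C.bang A)) (C.cunit A)) =
      C.toSMCData.cHom (C.ten_unit (C.bang A)).symm := by
  apply C.comp_cHom_cancel (C.ten_unit (C.bang A))
  rw [C.comp_assoc, C.cmul_counit_right, SMCData.cHom_cHom, SMCData.cHom_self]

/-- The codifferential vanishes on constants. -/
theorem bangMap_zero_dcirc (A B : C.Obj) :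
    C.comp (C.bangMap (C.zero : C.Hom A B)) (C.dcirc B) = C.zero := by
  rw [dcirc, ← C.comp_assoc, C.cmul_natural, C.comp_assoc, ← C.tHom_comp, C.eps_natural,
    C.comp_zero, C.tHom_zero_right, C.comp_zero]

/-- At the monoidal unit, differentiating and then codifferentiating is `J`. -/
theorem dR_dcircR : C.comp C.dR C.dcircR = C.J C.unit := by
  have slide : C.comp (C.tHom (C.der C.unit) (C.id (C.bang C.unit)))
      (C.tHom (C.id (C.bang C.unit)) (C.eps C.unit)) =
      C.comp (C.tHom (C.id (C.ten (C.bang C.unit) C.unit)) (C.eps C.unit))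
        (C.tHom (C.der C.unit) (C.id C.unit)) := by
    simp only [← C.tHom_comp, C.id_comp, C.comp_id]
  have counit := fun {D : C.Obj} (g : C.Hom _ D) => congrArg (fun f => C.comp f g)
    (C.cmul_tHom_cunit C.unit)
  simp only [C.comp_assoc] at counit
  have leibniz := congrArg (fun f => C.comp f
    (C.tHom (C.id (C.bang C.unit)) (C.eps C.unit))) (C.der_cmul C.unit)
  simp only [C.add_comp, C.comp_assoc, slide, ← SMCData.tHom_id_comp, C.der_eps] at leibniz
  rw [C.tHom_id_left_cHom (C.ten_unit (C.bang C.unit)) (C.eps C.unit)] at leibniz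
  simp only [tHom_unit, sw_unit_right, SMCData.tHom_id_comp, SMCData.tHom_id_cHom, C.comp_assoc,
    SMCData.cHom_cHom, SMCData.cHom_cHom_assoc, SMCData.cHom_self, C.id_comp, counit] at leibniz
  simp only [dR, dcircR, J, dcirc, cHom, C.comp_assoc]
  rw [← C.comp_assoc (C.cmul C.unit), ← C.comp_assoc (C.der C.unit), ← C.comp_assoc (C.der C.unit),
    C.comp_assoc (C.der C.unit), leibniz]
  simp only [C.add_comp, C.comp_add, C.comp_assoc, SMCData.cHom_cHom, SMCData.cHom_cHom_assoc,
    SMCData.cHom_self, C.id_comp, C.comp_id]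

end DiffCat

/-- Lemma 4.4 (sJ): if s_R : !R → !R satisfies [ftc.2], i.e.
s_R d_R + !(0) = 1_{!R}, then s_R J_R = d°_R. -/
theorem statement10 (C : DiffCat) (sR : C.Hom (C.bang C.unit) (C.bang C.unit))
    (hftc2 : C.add (C.comp sR C.dR) (C.bangMap (C.zero : C.Hom C.unit C.unit)) =
      C.id (C.bang C.unit)) :
    C.comp sR (C.J C.unit) = C.dcircR := by
  have vanish : C.comp (C.bangMap (C.zero : C.Hom C.unit C.unit)) C.dcircR = C.zero := by
    rw [DiffCat.dcircR, ← C.comp_assoc, C.bangMap_zero_dcirc, C.zero_comp]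
  rw [← C.dR_dcircR, ← C.comp_assoc, ← C.add_zero (C.comp _ _), ← vanish, ← C.add_comp, hftc2,
    C.id_comp]
end
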